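/- arXiv:1707.02797 — 2 statements merged into one kernel-verified Lean document; each statement's English description precedes it below -/
import Mathlib

section
/- Let A be a topological ring which contains an open subring A₀ whose induced topology is the I₀-adic topology, for some finitely generated ideal I₀ of A₀ (i.e. A is a Huber ring with ring of definition A₀ and ideal of definition I₀). Let B be a topological ring whose topology is the J-adic topology for some ideal J of B, and let φ : A → B be a continuous ring homomorphism. Then φ is still continuous when A is endowed with the (I₀·A)-adic topology, where I₀·A denotes the ideal of A generated by I₀. (Equivalently: the functor sending a Huber ring A to the ring A^/ — the same ring with the I₀A-adic topology — is left adjoint to the forgetful functor from adic rings to Huber rings.) -/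
open Topology

/-- Let `A` be a Huber ring with open ring of definition `A₀` whose induced topology is the
`I₀`-adic topology of a finitely generated ideal `I₀ ⊆ A₀`, let `B` be an adic ring (its
topology is the `J`-adic topology of an ideal `J`), and let `φ : A → B` be a continuous
ring homomorphism.  Then `φ` remains continuous when `A` is endowed with the
`I₀·A`-adic topology. -/
theorem continuous_adic_of_continuous_huber {A B : Type*}
    [CommRing A] [TopologicalSpace A] [IsTopologicalRing A]
    [CommRing B] [TopologicalSpace B] [IsTopologicalRing B]
    (A₀ : Subring A) (hA₀ : IsOpen (A₀ : Set A))
    (I₀ : Ideal A₀) (hfg : I₀.FG) (hadic : IsAdic I₀)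
    (J : Ideal B) (hJ : IsAdic J)
    (φ : A →+* B) (hφ : Continuous φ) :
    Continuous[(Ideal.map A₀.subtype I₀).adicTopology, inferInstance] ⇑φ := by
  have hpow (n : ℕ) : ∃ k, (Ideal.map A₀.subtype I₀) ^ k ≤ (J ^ n).comap φ := by
    have hcont : Continuous fun a : A₀ => φ a := hφ.comp continuous_subtype_val
    have hmem : ((J ^ n : Ideal B) : Set B) ∈ 𝓝 (φ ((0 : A₀) : A)) := by
      simpa using hJ.hasBasis_nhds_zero.mem_of_mem (i := n) trivial
    obtain ⟨k, -, hk⟩ := hadic.hasBasis_nhds_zero.mem_iff.mp (hcont.continuousAt hmem)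
    refine ⟨k, ?_⟩
    rw [← Ideal.map_pow, Ideal.map_le_iff_le_comap]
    exact fun a ha => hk ha
  refine (@continuous_iff_continuousAt A B (Ideal.map A₀.subtype I₀).adicTopology _ _).mpr
    fun x => ?_
  refine (((Ideal.map A₀.subtype I₀).hasBasis_nhds_adic x).tendsto_iff
    (hJ.hasBasis_nhds (φ x))).mpr fun n _ => ?_
  obtain ⟨k, hk⟩ := hpow n
  refine ⟨k, trivial, ?_⟩
  rintro _ ⟨a, ha, rfl⟩
  exact ⟨φ a, hk ha, (map_add φ x a).symm⟩
end

section
/- Let A be a noetherian commutative ring whose topology is the I-adic topology for an ideal I ⊆ A, and let B be a noetherian commutative ring whose topology is the J-adic topology for an ideal J ⊆ B, and assume B is complete and separated for this topology. Let φ : A → B be a continuous ring homomorphism such that the composite ring homomorphism A → B → B/J is of finite type. Then there exist integers n, m ≥ 0 and a surjective ring homomorphism ψ : A[T₁,…,Tₙ][[S₁,…,Sₘ]] → B extending φ (i.e. ψ restricted to A equals φ), which is continuous when the source R = A[T₁,…,Tₙ][[S₁,…,Sₘ]] is equipped with the (I·R + (S₁,…,Sₘ))-adic topology. -/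
open Topology

/-- Over a ring complete for the `J`-adic topology, power series in finitely many variables can be
evaluated at elements of `J`. -/
theorem MvPowerSeries.exists_ringHom_C_X {σ R B : Type*} [Finite σ] [CommRing R] [CommRing B]
    (J : Ideal B) [IsAdicComplete J B] (g : R →+* B) (c : σ → B) (hc : ∀ s, c s ∈ J) :
    ∃ ψ : MvPowerSeries σ R →+* B,
      ψ.comp MvPowerSeries.C = g ∧ ∀ s, ψ (MvPowerSeries.X s) = c s := by
  let : WithIdeal B := ⟨J⟩
  obtain ⟨_, _⟩ := (IsAdic.isAdicComplete_iff (R := B) (I := J) rfl).mp inferInstance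
  let : UniformSpace R := ⊥
  have : DiscreteUniformity R := ⟨rfl⟩
  have : IsUniformAddGroup R := ⟨DiscreteUniformity.uniformContinuous _ _⟩
  have hg : Continuous g := continuous_of_discreteTopology
  have he : MvPowerSeries.HasEval c :=
    ⟨fun s => WithIdeal.isTopologicallyNilpotent_of_mem (hc s), by simp⟩
  refine ⟨MvPowerSeries.eval₂Hom hg he, ?_, fun s => ?_⟩
  · ext r
    simp [MvPowerSeries.coe_eval₂Hom]
  · simp [MvPowerSeries.coe_eval₂Hom]

/-- A ring homomorphism from a power series ring onto a ring separated for the ideal generated by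
the images of the variables is surjective if it is so on constants modulo that ideal. -/
theorem MvPowerSeries.surjective_of_surjective_mk_comp_C {σ R B : Type*} [Finite σ] [CommRing R]
    [CommRing B] (J : Ideal B) [IsHausdorff J B] (ψ : MvPowerSeries σ R →+* B)
    (hJ : Ideal.span (Set.range fun s => ψ (MvPowerSeries.X s)) = J)
    (h : Function.Surjective (((Ideal.Quotient.mk J).comp ψ).comp MvPowerSeries.C)) :
    Function.Surjective ψ := by
  have hmap : (Ideal.span (Set.range (MvPowerSeries.X : σ → MvPowerSeries σ R))).map ψ = J := by
    rw [Ideal.map_span, ← Set.range_comp, ← hJ]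
    rfl
  subst hmap
  exact surjective_of_mk_map_comp_surjective ψ (Function.Surjective.of_comp h)

/-- A ring homomorphism into a ring with the `J`-adic topology is continuous for the `L`-adic
topology as soon as it maps a power of `L` into `J`. -/
theorem IsAdic.continuous_of_map_pow_le {R B : Type*} [CommRing R] [CommRing B]
    [TopologicalSpace B] [IsTopologicalRing B] {J : Ideal B} (hJ : IsAdic J) (L : Ideal R)
    (ψ : R →+* B) (r : ℕ) (h : (L ^ r).map ψ ≤ J) :
    Continuous[L.adicTopology, inferInstance] ψ := by
  let : TopologicalSpace R := L.adicTopology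
  have : IsTopologicalRing R := L.ringFilterBasis.isTopologicalRing
  refine continuous_of_continuousAt_zero ψ ?_
  have hL : IsAdic L := rfl
  rw [ContinuousAt, map_zero, hL.hasBasis_nhds_zero.tendsto_iff hJ.hasBasis_nhds_zero]
  refine fun k _ => ⟨r * k, trivial, fun x hx => ?_⟩
  rw [SetLike.mem_coe, pow_mul] at hx
  exact Ideal.pow_right_mono h k (Ideal.map_pow ψ (L ^ r) k ▸ Ideal.mem_map_of_mem ψ hx)

/-- A continuous ring homomorphism between adic rings maps a power of the first ideal into the
second one. -/
theorem IsAdic.exists_map_pow_le {A B : Type*} [CommRing A] [TopologicalSpace A] [CommRing B]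
    [TopologicalSpace B] {I : Ideal A} {J : Ideal B} (hI : IsAdic I) (hJ : IsAdic J)
    (φ : A →+* B) (hφ : Continuous φ) : ∃ r : ℕ, (I ^ r).map φ ≤ J := by
  have h := hφ.tendsto 0
  rw [map_zero, hI.hasBasis_nhds_zero.tendsto_iff hJ.hasBasis_nhds_zero] at h
  obtain ⟨r, -, hr⟩ := h 1 trivial
  exact ⟨r, Ideal.map_le_iff_le_comap.mpr fun x hx => by simpa using hr x hx⟩

/-- If `A → B / J` is of finite type, then finitely many elements of `B` generate `B / J` over
`A`. -/
theorem RingHom.FiniteType.exists_eval₂Hom_surjective {A B : Type*} [CommRing A] [CommRing B]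
    {J : Ideal B} {φ : A →+* B} (h : RingHom.FiniteType ((Ideal.Quotient.mk J).comp φ)) :
    ∃ (n : ℕ) (b : Fin n → B),
      Function.Surjective ((Ideal.Quotient.mk J).comp (MvPolynomial.eval₂Hom φ b)) := by
  let := ((Ideal.Quotient.mk J).comp φ).toAlgebra
  obtain ⟨n, f, hf⟩ := Algebra.FiniteType.iff_quotient_mvPolynomial''.mp h
  choose b hb using fun i => Ideal.Quotient.mk_surjective (f (MvPolynomial.X i))
  refine ⟨n, b, ?_⟩
  have : (Ideal.Quotient.mk J).comp (MvPolynomial.eval₂Hom φ b) = (f : _ →+* B ⧸ J) := by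
    ext i
    · simp [RingHom.algebraMap_toAlgebra]
    · simpa using hb i
  rw [this]
  exact hf

/-- Let `A` be a noetherian adic ring (topology `I`-adic), `B` a complete and separated
noetherian adic ring (topology `J`-adic), and `φ : A → B` a continuous ring homomorphism
such that the composite `A → B → B/J` is of finite type.  Then `φ` extends to a continuous
surjection `A[T₁,…,Tₙ][[S₁,…,Sₘ]] ↠ B`, where the source carries the
`(I·R + (S₁,…,Sₘ))`-adic topology. -/
theorem exists_surjective_mixed_affine {A B : Type*}
    [CommRing A] [TopologicalSpace A] [IsTopologicalRing A] [IsNoetherianRing A]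
    [CommRing B] [TopologicalSpace B] [IsTopologicalRing B] [IsNoetherianRing B]
    (I : Ideal A) (hI : IsAdic I)
    (J : Ideal B) (hJ : IsAdic J) (hB : IsAdicComplete J B)
    (φ : A →+* B) (hφ : Continuous φ)
    (hft : RingHom.FiniteType ((Ideal.Quotient.mk J).comp φ)) :
    ∃ (n m : ℕ)
      (ψ : MvPowerSeries (Fin m) (MvPolynomial (Fin n) A) →+* B),
      Function.Surjective ψ ∧
      ψ.comp ((MvPowerSeries.C (σ := Fin m) (R := MvPolynomial (Fin n) A)).comp MvPolynomial.C) = φ ∧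
      Continuous[(Ideal.map ((MvPowerSeries.C (σ := Fin m) (R := MvPolynomial (Fin n) A)).comp
            MvPolynomial.C) I ⊔
          Ideal.span (Set.range (MvPowerSeries.X :
            Fin m → MvPowerSeries (Fin m) (MvPolynomial (Fin n) A)))).adicTopology,
        inferInstance] ⇑ψ := by
  obtain ⟨n, b, hb⟩ := hft.exists_eval₂Hom_surjective
  obtain ⟨m, c, hc⟩ := Submodule.fg_iff_exists_fin_generating_family.mp (IsNoetherian.noetherian J)
  have hcJ (s : Fin m) : c s ∈ J := hc ▸ Submodule.subset_span ⟨s, rfl⟩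
  obtain ⟨ψ, hψC, hψX⟩ :=
    MvPowerSeries.exists_ringHom_C_X J (MvPolynomial.eval₂Hom φ b) c hcJ
  have hψ : ψ.comp (MvPowerSeries.C.comp MvPolynomial.C) = φ := by
    rw [← RingHom.comp_assoc, hψC, MvPolynomial.eval₂Hom_comp_C]
  refine ⟨n, m, ψ, ?_, hψ, ?_⟩
  · refine MvPowerSeries.surjective_of_surjective_mk_comp_C J ψ ?_ ?_
    · simpa only [hψX] using hc
    · rwa [RingHom.comp_assoc, hψC]
  · obtain ⟨r, hr⟩ := hI.exists_map_pow_le hJ φ hφ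
    refine hJ.continuous_of_map_pow_le _ ψ (r + 1) ?_
    rw [Ideal.map_pow, Ideal.map_sup, Ideal.map_map, hψ]
    have hX : (Ideal.span (Set.range (MvPowerSeries.X :
        Fin m → MvPowerSeries (Fin m) (MvPolynomial (Fin n) A)))).map ψ ≤ J := by
      rw [Ideal.map_span, Ideal.span_le]
      rintro _ ⟨_, ⟨s, rfl⟩, rfl⟩
      exact hψX s ▸ hcJ s
    refine Ideal.sup_pow_add_le_pow_sup_pow.trans
      (sup_le ?_ ((Ideal.pow_le_self one_ne_zero).trans hX))
    rwa [← Ideal.map_pow]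
end
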